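/- For any continuous map T of a compact metric space X and any set Y ⊆ X of totally full measure, the set Y \ Per(T) is either empty or has Bowen topological entropy equal to h_top(T). -/

import Mathlib

open MeasureTheory Filter Set Metric Topology NNReal ENNReal

noncomputable section

variable {X : Type*} [MetricSpace X] [CompactSpace X] [MeasurableSpace X] [BorelSpace X]

/-- Bowen dynamical ball of order `m` and radius `ε`. -/
def bowenBall (T : X → X) (x : X) (m : ℕ) (ε : ℝ) : Set X :=
  {y | ∀ j < m, dist (T^[j] x) (T^[j] y) ≤ ε}

/-- Weight `2 ^ (-t·m)` of an entry of a Bowen cover (`none` entries weigh `0`). -/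
def bowenWeight (t : ℝ≥0) (c : Option (X × ℕ)) : ℝ≥0∞ :=
  c.elim 0 fun p => (2 : ℝ≥0∞) ^ (-((t : ℝ) * (p.2 : ℝ)))

/-- A finite or countable cover of `E` by Bowen balls of order at least `n`. -/
def IsBowenCover (T : X → X) (E : Set X) (n : ℕ) (ε : ℝ)
    (c : ℕ → Option (X × ℕ)) : Prop :=
  (∀ i p, c i = some p → n ≤ p.2) ∧
    E ⊆ ⋃ i, (c i).elim ∅ fun p => bowenBall T p.1 p.2 ε

/-- The quantity `C(E; t, n, ε)` of Bowen. -/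
def bowenC (T : X → X) (E : Set X) (t : ℝ≥0) (n : ℕ) (ε : ℝ) : ℝ≥0∞ :=
  ⨅ (c : ℕ → Option (X × ℕ)) (_ : IsBowenCover T E n ε c), ∑' i, bowenWeight t (c i)

/-- Bowen entropy of `E` at scale `ε`: the critical exponent `t` at which
`C(E; t, ε) = lim_n C(E; t, n, ε)` vanishes. -/
def bowenEntropyOf (T : X → X) (E : Set X) (ε : ℝ) : ℝ≥0∞ :=
  ⨅ t : {t : ℝ≥0 // ⨆ n, bowenC T E t n ε = 0}, (t.1 : ℝ≥0∞)

/-- Bowen (dimension-like) topological entropy of an arbitrary subset `E ⊆ X`.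
For `E = univ` this is the topological entropy of `T`. -/
def bowenEntropy (T : X → X) (E : Set X) : ℝ≥0∞ :=
  ⨆ (ε : ℝ) (_ : 0 < ε), bowenEntropyOf T E ε

/-- Birkhoff average `(1/n) ∑_{i<n} φ(T^i x)`. -/
def birkhoffAvg (T : X → X) (φ : X → ℝ) (x : X) (n : ℕ) : ℝ :=
  (∑ i ∈ Finset.range n, φ (T^[i] x)) / n

/-- `x` is a generic point for `μ`: the empirical measures `Υ_n(x)` converge to `μ`
in the weak* topology, i.e. Birkhoff averages of every continuous function converge
to the corresponding integral. -/
def genericFor (T : X → X) (x : X) (μ : Measure X) : Prop :=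
  ∀ φ : X → ℝ, Continuous φ →
    Tendsto (fun n => birkhoffAvg T φ x n) atTop (𝓝 (∫ y, φ y ∂μ))

/-- `ρ` is a weak* limit point of the sequence of empirical measures of `x`,
i.e. `ρ ∈ M_x(T)`. -/
def limitMeasure (T : X → X) (x : X) (ρ : Measure X) : Prop :=
  ∃ n : ℕ → ℕ, StrictMono n ∧ ∀ φ : X → ℝ, Continuous φ →
    Tendsto (fun k => birkhoffAvg T φ x (n k)) atTop (𝓝 (∫ y, φ y ∂ρ))

/-- The (topological) support of a measure on a metric space. -/
def measSupport (μ : Measure X) : Set X := {x | ∀ ε > 0, 0 < μ (Metric.ball x ε)}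

/-- Lower visit frequency of the orbit of `x` in the set `E`. -/
def visitLiminf (T : X → X) (x : X) (E : Set X) : ℝ :=
  Filter.atTop.liminf fun n =>
    (∑ i ∈ Finset.range n, E.indicator (fun _ => (1 : ℝ)) (T^[i] x)) / n

/-- Upper visit frequency of the orbit of `x` in the set `E`. -/
def visitLimsup (T : X → X) (x : X) (E : Set X) : ℝ :=
  Filter.atTop.limsup fun n =>
    (∑ i ∈ Finset.range n, E.indicator (fun _ => (1 : ℝ)) (T^[i] x)) / n

/-- Weakly almost periodic points `W(T)`. -/
def weaklyAlmostPeriodicPts (T : X → X) : Set X :=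
  {x | ∀ ε > 0, 0 < visitLiminf T x (Metric.ball x ε)}

/-- Quasi-weakly almost periodic points `QW(T)`. -/
def quasiWeaklyAlmostPeriodicPts (T : X → X) : Set X :=
  {x | ∀ ε > 0, 0 < visitLimsup T x (Metric.ball x ε)}

/-- Recurrent points: `x ∈ ω_T(x)`. -/
def recurrentPts (T : X → X) : Set X :=
  {x | ∀ ε > 0, ∃ n ≥ 1, dist (T^[n] x) x < ε}

/-- Quasiregular points `QR(T)`: points generic for some invariant Borel probability
measure. -/
def quasiRegularPts (T : X → X) : Set X :=
  {x | ∃ μ : Measure X, IsProbabilityMeasure μ ∧ μ.map T = μ ∧ genericFor T x μ}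

/-- A (compact) minimal set: nonempty, closed, invariant, and every orbit in it is
dense in it. -/
def IsMinimalSet (T : X → X) (K : Set X) : Prop :=
  K.Nonempty ∧ IsClosed K ∧ Set.MapsTo T K K ∧
    ∀ y ∈ K, closure (Set.range fun n => T^[n] y) = K

/-- Almost periodic points `A(T)`: points lying in a compact minimal invariant set. -/
def almostPeriodicPts (T : X → X) : Set X :=
  {x | ∃ K, IsMinimalSet T K ∧ x ∈ K}

/-- Entropy `H(μ, ⋁_{k<n} T^{-k}ξ)` of the `n`-th dynamical refinement of the finite
partition coded by `p`. -/
def partitionDynEntropy (T : X → X) (μ : Measure X) (p : X → ℕ) (n : ℕ) : ℝ≥0∞ :=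
  ∑' f : Fin n → ℕ,
    ENNReal.ofReal (Real.negMulLog ((μ {x | ∀ k : Fin n, p (T^[(k : ℕ)] x) = f k}).toReal))

/-- Kolmogorov–Sinai (metric) entropy of `μ`: supremum over finite measurable
partitions of the exponential growth rate of the refined partition entropies. -/
def metricEntropy (T : X → X) (μ : Measure X) : ℝ≥0∞ :=
  ⨆ p : {p : X → ℕ // Measurable p ∧ (Set.range p).Finite},
    Filter.atTop.limsup fun n => partitionDynEntropy T μ p.1 n / (n : ℝ≥0∞)

/-- The periodic measure: uniform measure on the (periodic) orbit segment of length
`n` of `x`. -/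
def periodicOrbitMeasure (T : X → X) (x : X) (n : ℕ) : Measure X :=
  (n : ℝ≥0∞)⁻¹ • ∑ i ∈ Finset.range n, Measure.dirac (T^[i] x)

/-- Regular points `R(T) = ⋃_{μ ergodic} (G_μ ∩ supp μ)`. -/
def regularPts (T : X → X) : Set X :=
  {x | ∃ μ : Measure X, IsProbabilityMeasure μ ∧ Ergodic T μ ∧
    genericFor T x μ ∧ x ∈ measSupport μ}

/-- The set of integrals `∫ φ dμ` over all invariant Borel probability measures;
its infimum and supremum are the endpoints of the interval `L_φ`. -/
def invIntegralSet (T : X → X) (φ : X → ℝ) : Set ℝ :=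
  {r | ∃ μ : Measure X, IsProbabilityMeasure μ ∧ μ.map T = μ ∧ (∫ y, φ y ∂μ) = r}

/-- The entropy spectrum `Ψ(a) = sup {h_ρ(T) : ρ invariant, ∫φ dρ = a}`. -/
def entSpectrum (T : X → X) (φ : X → ℝ) (a : ℝ) : ℝ≥0∞ :=
  ⨆ (ρ : Measure X) (_ : IsProbabilityMeasure ρ ∧ ρ.map T = ρ ∧ (∫ y, φ y ∂ρ) = a),
    metricEntropy T ρ

/-- Number of visits to `V` among the first `n` points of the orbit. -/
def visitCount (T : X → X) (V : Set X) (x : X) (n : ℕ) : ℕ :=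
  open Classical in ((Finset.range n).filter fun i => T^[i] x ∈ V).card

lemma periodicOrbitMeasure_prob (T : X → X) (x : X) (n : ℕ) (hn : 0 < n) :
    IsProbabilityMeasure (periodicOrbitMeasure T x n) := by
  constructor
  simp only [periodicOrbitMeasure, Measure.smul_apply, Measure.finset_sum_apply, measure_univ,
    Finset.sum_const, Finset.card_range, smul_eq_mul, nsmul_eq_mul, mul_one]
  exact ENNReal.inv_mul_cancel (by exact_mod_cast hn.ne') (by simp)

lemma integral_periodicOrbitMeasure (T : X → X) (x : X) (n : ℕ) (f : X → ℝ)
    (hf : Continuous f) :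
    ∫ y, f y ∂(periodicOrbitMeasure T x n) = (n : ℝ)⁻¹ * ∑ i ∈ Finset.range n, f (T^[i] x) := by
  rw [periodicOrbitMeasure, integral_smul_measure, integral_finset_sum_measure]
  · simp
  · intro i _
    exact (integrable_dirac (by simp))

lemma periodicOrbitMeasure_apply (T : X → X) (x : X) (n : ℕ) (V : Set X)
    (hV : MeasurableSet V) :
    periodicOrbitMeasure T x n V = (n : ℝ≥0∞)⁻¹ * (visitCount T V x n : ℝ≥0∞) := by
  classical
  simp only [periodicOrbitMeasure, Measure.smul_apply, Measure.finset_sum_apply, smul_eq_mul,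
    Measure.dirac_apply' _ hV, visitCount]
  congr 1
  rw [Finset.card_filter]
  push_cast
  refine Finset.sum_congr rfl fun i _ => ?_
  by_cases h : T^[i] x ∈ V <;> simp [h]

/-- Krylov–Bogoliubov: a limit of empirical measures along longer and longer orbit segments is
invariant. -/
lemma limit_invariant (T : X → X) (hT : Continuous T) (F : Filter ℕ) [F.NeBot] (hF : F ≤ atTop)
    (n : ℕ → ℕ) (hn : ∀ k, k < n k) (x : ℕ → X) (ν : ℕ → ProbabilityMeasure X)
    (hν : ∀ k, (ν k : Measure X) = periodicOrbitMeasure T (x k) (n k))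
    (μ : ProbabilityMeasure X) (h : Tendsto ν F (𝓝 μ)) :
    (μ : Measure X).map T = μ := by
  haveI : IsProbabilityMeasure ((μ : Measure X).map T) :=
    Measure.isProbabilityMeasure_map hT.measurable.aemeasurable
  refine ext_of_forall_integral_eq_of_IsFiniteMeasure (fun f => ?_)
  rw [integral_map hT.measurable.aemeasurable f.continuous.aestronglyMeasurable]
  rw [ProbabilityMeasure.tendsto_iff_forall_integral_tendsto] at h
  have h1 := h f
  have h2 := h (f.compContinuous ⟨T, hT⟩)
  simp only [BoundedContinuousFunction.compContinuous_apply, ContinuousMap.coe_mk] at h2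
  have h3 : Tendsto (fun k => ∫ y, f (T y) ∂(ν k : Measure X) - ∫ y, f y ∂(ν k : Measure X)) F
      (𝓝 0) := by
    refine Tendsto.mono_left ?_ hF
    have hb : ∀ k : ℕ, ‖∫ y, f (T y) ∂(ν k : Measure X) - ∫ y, f y ∂(ν k : Measure X)‖
        ≤ (2 * ‖f‖) * (1 / ((k : ℝ) + 1)) := by
      intro k
      rw [hν, integral_periodicOrbitMeasure _ _ _ _ f.continuous,
        integral_periodicOrbitMeasure T _ _ (fun y => f (T y)) (f.continuous.comp hT), ← mul_sub,
        ← Finset.sum_sub_distrib]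
      have : ∑ i ∈ Finset.range (n k), (f (T (T^[i] (x k))) - f (T^[i] (x k)))
          = f (T^[n k] (x k)) - f (x k) := by
        have := Finset.sum_range_sub (fun i => f (T^[i] (x k))) (n k)
        simpa only [Function.iterate_succ_apply', Function.iterate_zero, id] using this
      rw [this, norm_mul, mul_comm]
      have hk : (k : ℝ) + 1 ≤ n k := by exact_mod_cast hn k
      have hk0 : (0 : ℝ) < (k : ℝ) + 1 := by positivity
      refine mul_le_mul ?_ ?_ (norm_nonneg _) (by positivity)
      · calc _ ≤ ‖f (T^[n k] (x k))‖ + ‖f (x k)‖ := norm_sub_le _ _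
          _ ≤ ‖f‖ + ‖f‖ := add_le_add (f.norm_coe_le_norm _) (f.norm_coe_le_norm _)
          _ = 2 * ‖f‖ := by ring
      · rw [norm_inv, Real.norm_natCast, one_div]
        exact inv_anti₀ hk0 hk
    refine squeeze_zero_norm hb ?_
    simpa using (tendsto_one_div_add_atTop_nhds_zero_nat (𝕜 := ℝ)).const_mul (2 * ‖f‖)
  have h4 := tendsto_nhds_unique (h2.sub h1) h3
  linarith

/-- A closed set that is null for every invariant measure has a neighbourhood visited with
uniformly small frequency. -/
lemma exists_rarely_visited_nhds (T : X → X) (hT : Continuous T) (K : Set X) (hK : IsClosed K)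
    (hK0 : ∀ μ : Measure X, IsProbabilityMeasure μ → μ.map T = μ → μ K = 0)
    (δ : ℝ) (hδ : 0 < δ) :
    ∃ V : Set X, IsOpen V ∧ K ⊆ V ∧ ∃ N : ℕ, ∀ n ≥ N, ∀ x, (visitCount T V x n : ℝ) ≤ δ * n := by
  by_contra hcon
  push Not at hcon
  have key : ∀ k : ℕ, ∃ n : ℕ, k < n ∧ ∃ x : X,
      δ * n < visitCount T (thickening (1 / ((k : ℝ) + 1)) K) x n := by
    intro k
    obtain ⟨n, hn, x, hx⟩ := hcon _ (isOpen_thickening (δ := 1 / ((k : ℝ) + 1)) (E := K))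
      (self_subset_thickening (by positivity) K) (k + 1)
    exact ⟨n, hn, x, hx⟩
  choose n hn x hx using key
  let ν : ℕ → ProbabilityMeasure X := fun k =>
    ⟨periodicOrbitMeasure T (x k) (n k), periodicOrbitMeasure_prob _ _ _ (by have := hn k; omega)⟩
  let F : Ultrafilter ℕ := Filter.hyperfilter ℕ
  have hF : (F : Filter ℕ) ≤ atTop := Nat.hyperfilter_le_atTop
  obtain ⟨μ, -, hμ⟩ := isCompact_univ.ultrafilter_le_nhds (F.map ν) (by simp)
  have hμ' : Tendsto ν F (𝓝 μ) := hμ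
  have hinv := limit_invariant T hT F hF n hn x ν (fun k => rfl) μ hμ'
  have h0 := hK0 μ inferInstance hinv
  have hlow : ∀ j : ℕ, ENNReal.ofReal δ ≤ (μ : Measure X) (cthickening (1 / ((j : ℝ) + 1)) K) := by
    intro j
    refine le_trans ?_ (ProbabilityMeasure.limsup_measure_closed_le_of_tendsto hμ'
      (isClosed_cthickening (δ := 1 / ((j : ℝ) + 1)) (E := K)))
    refine Filter.le_limsup_of_frequently_le (Eventually.frequently ?_) 
    refine hF (Filter.mem_of_superset (Filter.Ici_mem_atTop j) fun k hk => ?_)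
    have hsub : thickening (1 / ((k : ℝ) + 1)) K ⊆ cthickening (1 / ((j : ℝ) + 1)) K := by
      refine (thickening_subset_cthickening _ _).trans (cthickening_mono ?_ _)
      have : (j : ℝ) ≤ k := by exact_mod_cast hk
      exact one_div_le_one_div_of_le (by positivity) (by linarith)
    refine le_trans ?_ (measure_mono hsub)
    change _ ≤ periodicOrbitMeasure T (x k) (n k) _
    rw [periodicOrbitMeasure_apply _ _ _ _ isOpen_thickening.measurableSet]
    have hnk : (0 : ℝ) < n k := by exact_mod_cast (lt_of_le_of_lt (Nat.zero_le _) (hn k))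
    have e : (n k : ℝ≥0∞)⁻¹ * (visitCount T (thickening (1 / ((k : ℝ) + 1)) K) (x k) (n k) : ℝ≥0∞)
        = ENNReal.ofReal ((visitCount T (thickening (1 / ((k : ℝ) + 1)) K) (x k) (n k) : ℝ) / n k)
        := by
      rw [ENNReal.ofReal_div_of_pos hnk, ENNReal.ofReal_natCast, ENNReal.ofReal_natCast,
        ENNReal.div_eq_inv_mul]
    rw [e]
    refine ENNReal.ofReal_le_ofReal ?_
    rw [le_div_iff₀ hnk]
    exact (hx k).le
  have hlim : Tendsto (fun r => (μ : Measure X) (cthickening r K)) (𝓝 0) (𝓝 ((μ : Measure X) K)) :=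
    tendsto_measure_cthickening_of_isClosed ⟨1, one_pos, measure_ne_top _ _⟩ hK
  have hlim2 := hlim.comp (tendsto_one_div_add_atTop_nhds_zero_nat (𝕜 := ℝ))
  have := ge_of_tendsto' hlim2 hlow
  rw [h0] at this
  simp only [nonpos_iff_eq_zero, ENNReal.ofReal_eq_zero] at this
  linarith

lemma visitCount_add (T : X → X) (V : Set X) (x : X) (a b : ℕ) :
    visitCount T V x (a + b) = visitCount T V x a + visitCount T V (T^[a] x) b := by
  classical
  simp only [visitCount, Finset.card_filter]
  rw [Finset.sum_range_add]
  congr 1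
  refine Finset.sum_congr rfl fun i _ => ?_
  rw [← Function.iterate_add_apply, add_comm i a]

/-- `(n, r)`-separated finite sets. -/
def DynSep (T : X → X) (n : ℕ) (r : ℝ) (S : Finset X) : Prop :=
  ∀ x ∈ S, ∀ y ∈ S, x ≠ y → ∃ j < n, r < dist (T^[j] x) (T^[j] y)

/-- Shifting a separated set contained in a dynamically small set. -/
lemma DynSep.image_iterate [DecidableEq X] (T : X → X) (n m : ℕ) (r : ℝ) (S : Finset X)
    (hS : DynSep T n r S)
    (hsmall : ∀ x ∈ S, ∀ y ∈ S, ∀ j < m, dist (T^[j] x) (T^[j] y) ≤ r) :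
    DynSep T (n - m) r (S.image T^[m]) ∧ (S.image T^[m]).card = S.card := by
  have key : ∀ x ∈ S, ∀ y ∈ S, x ≠ y → ∃ j < n - m,
      r < dist (T^[j] (T^[m] x)) (T^[j] (T^[m] y)) := by
    intro x hx y hy hxy
    obtain ⟨j, hj, hd⟩ := hS x hx y hy hxy
    have hmj : m ≤ j := by
      by_contra h
      exact absurd hd (not_lt.2 (hsmall x hx y hy j (by omega)))
    refine ⟨j - m, by omega, ?_⟩
    rw [← Function.iterate_add_apply, ← Function.iterate_add_apply, Nat.sub_add_cancel hmj]
    exact hd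
  constructor
  · intro x hx y hy hxy
    obtain ⟨x', hx', rfl⟩ := Finset.mem_image.1 hx
    obtain ⟨y', hy', rfl⟩ := Finset.mem_image.1 hy
    exact key x' hx' y' hy' (fun h => hxy (by rw [h]))
  · refine Finset.card_image_of_injOn fun x hx y hy hxy => ?_
    by_contra hne
    obtain ⟨j, hj, hd⟩ := key x hx y hy hne
    have hxy' : T^[m] x = T^[m] y := hxy
    -- the first distance before time `m` decides
    obtain ⟨i, hi, hdi⟩ := hS x hx y hy hne
    have hmi : m ≤ i := by
      by_contra h
      exact absurd hdi (not_lt.2 (hsmall x hx y hy i (by omega)))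
    have hr : 0 ≤ r ∨ r < 0 := le_or_gt 0 r
    rw [hxy', dist_self] at hd
    rcases Nat.eq_zero_or_pos m with h0 | h0
    · subst h0; exact hne hxy'
    · have := hsmall x hx x hx 0 h0
      rw [dist_self] at this
      linarith

lemma sep_card_le (T : X → X) (V : Set X) (r : ℝ) (P : Finset (X × ℕ)) (G : X × ℕ → Set X)
    (M L : ℕ) (Q : Finset X) (D : X → Set X) (s : ℝ) (hs : 0 ≤ s)
    (hG : ∀ p ∈ P, ∀ x ∈ G p, ∀ y ∈ G p, ∀ j < p.2, dist (T^[j] x) (T^[j] y) ≤ r)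
    (hP1 : ∀ p ∈ P, 1 ≤ p.2) (hPM : ∀ p ∈ P, p.2 ≤ M)
    (hcov : ∀ x, x ∉ V → ∃ p ∈ P, x ∈ G p)
    (hD : ∀ q ∈ Q, ∀ x ∈ D q, ∀ y ∈ D q, dist x y ≤ r)
    (hcovD : ∀ x, ∃ q ∈ Q, x ∈ D q)
    (hsum : ∑ p ∈ P, (2 : ℝ) ^ (-(s * (p.2 : ℝ))) ≤ 1 / 2)
    (hL : 2 * (Q.card : ℝ) ≤ (2 : ℝ) ^ (L : ℝ)) :
    ∀ (n k : ℕ) (S : Finset X), DynSep T n r S → (∀ x ∈ S, visitCount T V x n ≤ k) →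
      (S.card : ℝ) ≤ (2 : ℝ) ^ (s * ((n : ℝ) + M) + L * k) := by
  classical
  intro n
  induction n using Nat.strong_induction_on with
  | _ n ih =>
  intro k S hS hk
  have one_le : ∀ a : ℝ, 0 ≤ a → (1 : ℝ) ≤ 2 ^ a := fun a ha =>
    Real.one_le_rpow (by norm_num) ha
  have card_one : ∀ S' : Finset X, DynSep T 0 r S' → (S'.card : ℝ) ≤ 1 := by
    intro S' hS'
    have : S'.card ≤ 1 := Finset.card_le_one.2 fun x hx y hy => by
      by_contra hne
      obtain ⟨j, hj, -⟩ := hS' x hx y hy hne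
      omega
    exact_mod_cast this
  rcases Nat.eq_zero_or_pos n with rfl | hn
  · exact (card_one S hS).trans (one_le _ (by positivity))
  have hSub : S ⊆ (P.biUnion fun p => S.filter (· ∈ G p)) ∪
      (Q.biUnion fun q => S.filter (fun x => x ∈ V ∧ x ∈ D q)) := by
    intro x hx
    by_cases hxV : x ∈ V
    · obtain ⟨q, hq, hxq⟩ := hcovD x
      exact Finset.mem_union_right _ (Finset.mem_biUnion.2 ⟨q, hq, by simp [hx, hxV, hxq]⟩)
    · obtain ⟨p, hp, hxp⟩ := hcov x hxV
      exact Finset.mem_union_left _ (Finset.mem_biUnion.2 ⟨p, hp, by simp [hx, hxp]⟩)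
  have hcard : (S.card : ℝ) ≤ ∑ p ∈ P, ((S.filter (· ∈ G p)).card : ℝ) +
      ∑ q ∈ Q, ((S.filter (fun x => x ∈ V ∧ x ∈ D q)).card : ℝ) := by
    have := (Finset.card_le_card hSub).trans ((Finset.card_union_le _ _).trans
      (add_le_add Finset.card_biUnion_le Finset.card_biUnion_le))
    exact_mod_cast this
  set B : ℝ := (2 : ℝ) ^ (s * ((n : ℝ) + M) + L * k) with hB
  have hBpos : 0 < B := by positivity
  have hgood : ∀ p ∈ P, ((S.filter (· ∈ G p)).card : ℝ) ≤ B * (2 : ℝ) ^ (-(s * (p.2 : ℝ))) := by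
    intro p hp
    rw [hB, ← Real.rpow_add (by norm_num)]
    obtain ⟨h1, h2⟩ := DynSep.image_iterate T n p.2 r (S.filter (· ∈ G p))
      (fun x hx y hy => hS x (Finset.mem_filter.1 hx).1 y (Finset.mem_filter.1 hy).1)
      (fun x hx y hy => hG p hp x (Finset.mem_filter.1 hx).2 y (Finset.mem_filter.1 hy).2)
    rw [← h2]
    rcases le_total p.2 n with hpn | hpn
    · have := ih (n - p.2) (by have := hP1 p hp; omega) k _ h1 (by
        intro x hx
        obtain ⟨y, hy, rfl⟩ := Finset.mem_image.1 hx
        have h3 := hk y (Finset.mem_filter.1 hy).1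
        have h4 := visitCount_add T V y p.2 (n - p.2)
        rw [Nat.add_sub_cancel' hpn] at h4
        omega)
      refine this.trans (le_of_eq ?_)
      rw [Nat.cast_sub hpn]
      congr 1
      ring
    · rw [Nat.sub_eq_zero_of_le hpn] at h1
      refine (card_one _ h1).trans (one_le _ ?_)
      have : (p.2 : ℝ) ≤ M := by exact_mod_cast hPM p hp
      have h5 : 0 ≤ s * ((n : ℝ) + M - p.2) := mul_nonneg hs (by
        have : (0 : ℝ) ≤ n := Nat.cast_nonneg n
        linarith)
      have h6 : (0 : ℝ) ≤ L * k := by positivity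
      linarith
  have hbad : ∀ q ∈ Q, ((S.filter (fun x => x ∈ V ∧ x ∈ D q)).card : ℝ) ≤
      B * (2 : ℝ) ^ (-(L : ℝ)) := by
    intro q hq
    rcases Finset.eq_empty_or_nonempty (S.filter (fun x => x ∈ V ∧ x ∈ D q)) with he | ⟨z, hz⟩
    · rw [he]; simp only [Finset.card_empty, Nat.cast_zero]; positivity
    obtain ⟨h1, h2⟩ := DynSep.image_iterate T n 1 r (S.filter (fun x => x ∈ V ∧ x ∈ D q))
      (fun x hx y hy => hS x (Finset.mem_filter.1 hx).1 y (Finset.mem_filter.1 hy).1)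
      (fun x hx y hy j hj => by
        obtain rfl : j = 0 := by omega
        exact hD q hq x (Finset.mem_filter.1 hx).2.2 y (Finset.mem_filter.1 hy).2.2)
    have hvis : ∀ x ∈ S.filter (fun x => x ∈ V ∧ x ∈ D q),
        visitCount T V (T^[1] x) (n - 1) + 1 ≤ k := by
      intro x hx
      have h3 := hk x (Finset.mem_filter.1 hx).1
      have h4 := visitCount_add T V x 1 (n - 1)
      have h5 : visitCount T V x 1 = 1 := by
        simp [visitCount, Finset.filter_singleton, (Finset.mem_filter.1 hx).2.1]
      rw [Nat.add_sub_cancel' hn] at h4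
      omega
    have hk1 : 1 ≤ k := by have := hvis z hz; omega
    rw [← h2]
    have := ih (n - 1) (by omega) (k - 1) _ h1 (by
        intro x hx
        obtain ⟨y, hy, rfl⟩ := Finset.mem_image.1 hx
        have := hvis y hy
        omega)
    refine this.trans ?_
    rw [hB, ← Real.rpow_add (by norm_num)]
    refine Real.rpow_le_rpow_of_exponent_le (by norm_num) ?_
    rw [Nat.cast_sub hk1, Nat.cast_sub (show 1 ≤ n from hn)]
    push_cast
    nlinarith
  have hL' : (Q.card : ℝ) * (2 : ℝ) ^ (-(L : ℝ)) ≤ 1 / 2 := by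
    rw [Real.rpow_neg (by norm_num), ← div_eq_mul_inv, div_le_iff₀ (by positivity)]
    linarith
  calc (S.card : ℝ) ≤ ∑ p ∈ P, B * (2 : ℝ) ^ (-(s * (p.2 : ℝ))) +
        ∑ q ∈ Q, B * (2 : ℝ) ^ (-(L : ℝ)) :=
        hcard.trans (add_le_add (Finset.sum_le_sum hgood) (Finset.sum_le_sum hbad))
    _ = B * ∑ p ∈ P, (2 : ℝ) ^ (-(s * (p.2 : ℝ))) + B * (Q.card * (2 : ℝ) ^ (-(L : ℝ))) := by
        rw [Finset.mul_sum, Finset.sum_const, nsmul_eq_mul]; ring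
    _ ≤ B * (1 / 2) + B * (1 / 2) :=
        add_le_add (mul_le_mul_of_nonneg_left hsum hBpos.le)
          (mul_le_mul_of_nonneg_left hL' hBpos.le)
    _ = B := by ring

/-- Weighted covers by an arbitrary set of Bowen balls. -/
def SmallCover (T : X → X) (A : Set X) (s : ℝ) (ε : ℝ) (b : ℝ≥0∞) : Prop :=
  ∃ S : Set (X × ℕ), (∀ q ∈ S, 1 ≤ q.2) ∧ A ⊆ ⋃ q ∈ S, bowenBall T q.1 q.2 ε ∧
    ∑' q : S, (2 : ℝ≥0∞) ^ (-(s * ((q : X × ℕ).2 : ℝ))) ≤ b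

lemma SmallCover.union {T : X → X} {A A' : Set X} {s ε : ℝ} {b b' : ℝ≥0∞}
    (h : SmallCover T A s ε b) (h' : SmallCover T A' s ε b') :
    SmallCover T (A ∪ A') s ε (b + b') := by
  obtain ⟨S, h1, h2, h3⟩ := h
  obtain ⟨S', h1', h2', h3'⟩ := h'
  refine ⟨S ∪ S', ?_, ?_, ?_⟩
  · rintro q (hq | hq)
    exacts [h1 q hq, h1' q hq]
  · rw [biUnion_union]
    exact union_subset_union h2 h2'
  · exact (ENNReal.tsum_union_le (fun q : X × ℕ => (2 : ℝ≥0∞) ^ (-(s * (q.2 : ℝ)))) S S').trans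
      (add_le_add h3 h3')

lemma SmallCover.iUnion {T : X → X} {A : ℕ → Set X} {s ε : ℝ} {b : ℕ → ℝ≥0∞}
    (h : ∀ i, SmallCover T (A i) s ε (b i)) :
    SmallCover T (⋃ i, A i) s ε (∑' i, b i) := by
  choose S h1 h2 h3 using h
  refine ⟨⋃ i, S i, ?_, ?_, ?_⟩
  · intro q hq
    obtain ⟨i, hi⟩ := mem_iUnion.1 hq
    exact h1 i q hi
  · refine iUnion_subset fun i => (h2 i).trans ?_
    exact biUnion_subset_biUnion_left (subset_iUnion S i)
  · exact (ENNReal.tsum_iUnion_le_tsum (fun q : X × ℕ => (2 : ℝ≥0∞) ^ (-(s * (q.2 : ℝ)))) S).trans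
      (ENNReal.tsum_le_tsum h3)

lemma smallCover_of_bowenC (T : X → X) (E : Set X) (t : ℝ≥0) (s ε : ℝ) (hts : (t : ℝ) ≤ s)
    (b : ℝ≥0∞) (h : bowenC T E t 1 ε < b) : SmallCover T E s ε b := by
  simp only [bowenC, iInf_lt_iff] at h
  obtain ⟨c, ⟨hc1, hc2⟩, hc⟩ := h
  refine ⟨{p | ∃ i, c i = some p}, ?_, ?_, ?_⟩
  · rintro q ⟨i, hi⟩
    exact hc1 i q hi
  · intro x hx
    obtain ⟨i, hi⟩ := mem_iUnion.1 (hc2 hx)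
    rcases hci : c i with _ | p
    · simp [hci] at hi
    · rw [hci] at hi
      exact mem_iUnion₂.2 ⟨p, ⟨i, hci⟩, hi⟩
  · refine le_trans ?_ hc.le
    have hch : ∀ q : {p | ∃ i, c i = some p}, ∃ i, c i = some (q : X × ℕ) := fun q => q.2
    choose g hg using hch
    have hginj : Function.Injective g := by
      intro a a' haa
      have := hg a
      rw [haa, hg a'] at this
      exact Subtype.ext (Option.some.inj this).symm
    refine le_trans (ENNReal.tsum_le_tsum fun q => ?_)
      (ENNReal.tsum_comp_le_tsum_of_injective hginj (fun i => bowenWeight t (c i)))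
    rw [hg q]
    simp only [bowenWeight, Option.elim]
    refine ENNReal.rpow_le_rpow_of_exponent_le (by norm_num) ?_
    exact neg_le_neg (mul_le_mul_of_nonneg_right hts (by positivity))

lemma tendsto_two_rpow (s : ℝ) (hs : 0 < s) :
    Tendsto (fun n : ℕ => (2 : ℝ≥0∞) ^ (-(s * (n : ℝ)))) atTop (𝓝 0) := by
  have h1 : (2 : ℝ≥0∞) ^ (-s) < 1 := by
    apply ENNReal.rpow_lt_one_of_one_lt_of_neg (by norm_num) (by linarith)
  refine (ENNReal.tendsto_pow_atTop_nhds_zero_of_lt_one h1).congr fun n => ?_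
  rw [← ENNReal.rpow_natCast, ← ENNReal.rpow_mul, neg_mul]

lemma isOpen_bowenBall' (T : X → X) (hT : Continuous T) (x : X) (m : ℕ) (ε : ℝ) :
    IsOpen {y | ∀ j < m, dist (T^[j] x) (T^[j] y) < ε} := by
  have : {y | ∀ j < m, dist (T^[j] x) (T^[j] y) < ε} =
      ⋂ j ∈ Finset.range m, {y | dist (T^[j] x) (T^[j] y) < ε} := by
    ext y; simp
  rw [this]
  refine isOpen_biInter_finset fun j _ => ?_
  exact isOpen_lt (continuous_const.dist (hT.iterate j)) continuous_const

lemma smallCover_fixed (T : X → X) (hT : Continuous T) (p : ℕ) (hp : 0 < p) (s ε : ℝ)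
    (hs : 0 < s) (hε : 0 < ε) (b : ℝ≥0∞) (hb : b ≠ 0) :
    SmallCover T {x | Function.IsPeriodicPt T p x} s ε b := by
  classical
  have hclosed : IsClosed {x | Function.IsPeriodicPt T p x} :=
    isClosed_eq (hT.iterate p) continuous_id
  obtain ⟨F, hF1, hF2⟩ := hclosed.isCompact.elim_nhds_subcover
    (fun x => {y | ∀ j < p, dist (T^[j] x) (T^[j] y) < ε})
    (fun x _ => (isOpen_bowenBall' T hT x p ε).mem_nhds (by simp [hε]))
  have hlim : Tendsto (fun m : ℕ => (F.card : ℝ≥0∞) * (2 : ℝ≥0∞) ^ (-(s * (m : ℝ)))) atTop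
      (𝓝 0) := by
    simpa using ENNReal.Tendsto.const_mul (tendsto_two_rpow s hs)
      (Or.inr (ENNReal.natCast_ne_top F.card))
  obtain ⟨m, hm, hm1⟩ := ((hlim.eventually (gt_mem_nhds (pos_iff_ne_zero.2 hb))).and
    (eventually_ge_atTop 1)).exists
  refine ⟨((F.image fun x => (x, m) : Finset (X × ℕ)) : Set (X × ℕ)), ?_, ?_, ?_⟩
  · intro q hq
    obtain ⟨x, -, rfl⟩ := Finset.mem_image.1 (Finset.mem_coe.1 hq)
    exact hm1
  · intro y hy
    obtain ⟨x, hx, hxy⟩ := mem_iUnion₂.1 (hF2 hy)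
    refine mem_iUnion₂.2 ⟨(x, m), by simpa using hx, ?_⟩
    intro j _
    have hx' : Function.IsPeriodicPt T p x := hF1 x hx
    have hy' : Function.IsPeriodicPt T p y := hy
    change dist (T^[j] x) (T^[j] y) ≤ ε
    rw [← hx'.iterate_mod_apply j, ← hy'.iterate_mod_apply j]
    exact (hxy _ (Nat.mod_lt _ hp)).le
  · refine le_trans ?_ hm.le
    rw [Finset.tsum_subtype' (F.image fun x => (x, m))
      (fun q : X × ℕ => (2 : ℝ≥0∞) ^ (-(s * (q.2 : ℝ))))]
    rw [Finset.sum_image (by intro a _ a' _ h; exact (Prod.mk.inj h).1)]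
    simp

lemma smallCover_periodicPts (T : X → X) (hT : Continuous T) (s ε : ℝ)
    (hs : 0 < s) (hε : 0 < ε) (b : ℝ≥0∞) (hb : b ≠ 0) :
    SmallCover T (Function.periodicPts T) s ε b := by
  obtain ⟨b', hb', hsum⟩ := ENNReal.exists_pos_sum_of_countable hb ℕ
  have h := SmallCover.iUnion (T := T) (s := s) (ε := ε) (b := fun i => (b' i : ℝ≥0∞))
    (A := fun i => {x | Function.IsPeriodicPt T (i + 1) x})
    (fun i => smallCover_fixed T hT (i + 1) (by omega) s ε hs hε _
      (by exact_mod_cast (hb' i).ne'))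
  obtain ⟨S, h1, h2, h3⟩ := h
  refine ⟨S, h1, ?_, h3.trans hsum.le⟩
  refine subset_trans ?_ h2
  rintro x ⟨n, hn, hx⟩
  refine mem_iUnion.2 ⟨n - 1, ?_⟩
  change Function.IsPeriodicPt T (n - 1 + 1) x
  rwa [Nat.sub_add_cancel hn]

lemma bowenC_univ_le (T : X → X) (n : ℕ) (r : ℝ) (hr : 0 ≤ r) (t : ℝ≥0) (B : ℝ)
    (hB : ∀ S : Finset X, DynSep T n r S → (S.card : ℝ) ≤ B) :
    bowenC T univ t n r ≤ ENNReal.ofReal B * (2 : ℝ≥0∞) ^ (-((t : ℝ) * (n : ℝ))) := by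
  classical
  have hex : ∃ S : Finset X, DynSep T n r S ∧ ∀ x, ∃ y ∈ S, x ∈ bowenBall T y n r := by
    by_contra hcon
    push Not at hcon
    have hall : ∀ m : ℕ, ∃ S : Finset X, DynSep T n r S ∧ S.card = m := by
      intro m
      induction m with
      | zero => exact ⟨∅, by intro x hx; simp at hx, rfl⟩
      | succ m ih =>
        obtain ⟨S, hS, hm⟩ := ih
        obtain ⟨x, hx⟩ := hcon S hS
        have hx' : ∀ y ∈ S, ∃ j < n, r < dist (T^[j] y) (T^[j] x) := by
          intro y hy
          have := hx y hy
          simp only [bowenBall, mem_setOf_eq] at this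
          push Not at this
          exact this
        by_cases hxS : x ∈ S
        · obtain ⟨j, _, hd⟩ := hx' x hxS
          rw [dist_self] at hd
          linarith
        · refine ⟨insert x S, ?_, by rw [Finset.card_insert_of_notMem hxS, hm]⟩
          intro a ha a' ha' hne
          rcases Finset.mem_insert.1 ha with rfl | haS
          · rcases Finset.mem_insert.1 ha' with rfl | ha'
            · exact absurd rfl hne
            · obtain ⟨j, hj, hd⟩ := hx' a' ha'
              exact ⟨j, hj, by rwa [dist_comm]⟩
          · rcases Finset.mem_insert.1 ha' with rfl | ha'
            · exact hx' a haS
            · exact hS a haS a' ha' hne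
    obtain ⟨m, hm⟩ := exists_nat_gt B
    obtain ⟨S, hS, hSm⟩ := hall m
    have := hB S hS
    rw [hSm] at this
    linarith
  obtain ⟨S, hS, hcov⟩ := hex
  have hle := hB S hS
  have hIs : IsBowenCover T univ n r (fun i => (S.toList[i]?).map fun x => (x, n)) := by
    refine ⟨?_, ?_⟩
    · intro i p hp
      simp only [Option.map_eq_some_iff] at hp
      obtain ⟨x, -, rfl⟩ := hp
      exact le_rfl
    · intro x _
      obtain ⟨y, hy, hxy⟩ := hcov x
      obtain ⟨i, hi⟩ := List.mem_iff_getElem?.1 (Finset.mem_toList.2 hy)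
      refine mem_iUnion.2 ⟨i, ?_⟩
      simpa [hi] using hxy
  refine (iInf₂_le _ hIs).trans ?_
  · rw [tsum_eq_sum (s := Finset.range S.toList.length)]
    · refine (Finset.sum_le_card_nsmul _ _ ((2 : ℝ≥0∞) ^ (-((t : ℝ) * (n : ℝ)))) ?_).trans ?_
      · intro i hi
        beta_reduce
        rcases hy : S.toList[i]? with _ | y
        · exact zero_le
        · exact le_rfl
      · rw [nsmul_eq_mul, Finset.card_range, Finset.length_toList]
        gcongr
        rw [← ENNReal.ofReal_natCast]
        exact ENNReal.ofReal_le_ofReal hle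
    · intro i hi
      rw [Finset.mem_range, not_lt] at hi
      simp [bowenWeight, List.getElem?_eq_none hi]

lemma bowenC_mono_order (T : X → X) (E : Set X) (t : ℝ≥0) (ε : ℝ) {n m : ℕ} (h : n ≤ m) :
    bowenC T E t n ε ≤ bowenC T E t m ε := by
  refine le_iInf₂ fun c hc => iInf₂_le c ⟨fun i p hp => h.trans (hc.1 i p hp), hc.2⟩

lemma bowenC_mono_set (T : X → X) {E E' : Set X} (t : ℝ≥0) (ε : ℝ) (n : ℕ) (h : E ⊆ E') :
    bowenC T E t n ε ≤ bowenC T E' t n ε := by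
  refine le_iInf₂ fun c hc => iInf₂_le c ⟨hc.1, h.trans hc.2⟩

lemma main_estimate (T : X → X) (hT : Continuous T) (Y : Set X)
    (hY : ∀ μ : Measure X, IsProbabilityMeasure μ → μ.map T = μ → μ Y = 1)
    (ε : ℝ) (hε : 0 < ε) (t η : ℝ≥0) (hη : 0 < η)
    (hE : bowenC T (Y \ Function.periodicPts T) t 1 ε = 0) :
    ⨆ n, bowenC T univ (t + 3 * η) n (4 * ε) = 0 := by
  classical
  have hη' : (0 : ℝ) < η := by exact_mod_cast hη
  have ht0 : (0 : ℝ) ≤ t := t.2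
  set s : ℝ := t + η with hs_def
  have hs : 0 < s := by positivity
  -- a cover of `Y` of small weight
  have hcov1 : SmallCover T (Y \ Function.periodicPts T) s ε (1 / 4) :=
    smallCover_of_bowenC T _ t s ε (by linarith) _ (by rw [hE]; norm_num)
  have hcov2 : SmallCover T (Function.periodicPts T) s ε (1 / 4) :=
    smallCover_periodicPts T hT s ε hs hε _ (by norm_num)
  obtain ⟨S, hS1, hS2, hS3⟩ := hcov1.union hcov2
  have hhalf : (1 / 4 + 1 / 4 : ℝ≥0∞) = ENNReal.ofReal (1 / 2) := by
    rw [show (1 / 4 : ℝ≥0∞) = ENNReal.ofReal (1 / 4) by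
      rw [ENNReal.ofReal_div_of_pos (by norm_num)]; norm_num]
    rw [← ENNReal.ofReal_add (by norm_num) (by norm_num)]
    norm_num
  rw [hhalf] at hS3
  -- open dynamical balls
  let G : X × ℕ → Set X := fun q => {y | ∀ j < q.2, dist (T^[j] q.1) (T^[j] y) < 2 * ε}
  have hGopen : ∀ q, IsOpen (G q) := fun q => isOpen_bowenBall' T hT q.1 q.2 (2 * ε)
  let U : Set X := ⋃ q ∈ S, G q
  have hUopen : IsOpen U := isOpen_biUnion fun q _ => hGopen q
  have hYU : Y ⊆ U := by
    intro x hx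
    have hx' : x ∈ (Y \ Function.periodicPts T) ∪ Function.periodicPts T := by
      by_cases h : x ∈ Function.periodicPts T
      · exact Or.inr h
      · exact Or.inl ⟨hx, h⟩
    obtain ⟨q, hq, hxq⟩ := mem_iUnion₂.1 (hS2 hx')
    refine mem_iUnion₂.2 ⟨q, hq, fun j hj => ?_⟩
    have := hxq j hj
    linarith
  have hK0 : ∀ μ : Measure X, IsProbabilityMeasure μ → μ.map T = μ → μ Uᶜ = 0 := by
    intro μ hμ hinv
    rw [prob_compl_eq_zero_iff hUopen.measurableSet]
    exact le_antisymm prob_le_one ((hY μ hμ hinv).symm.le.trans (measure_mono hYU))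
  -- a finite cover of `X` by small balls
  obtain ⟨Q, -, hQ⟩ := isCompact_univ.elim_nhds_subcover (fun x : X => ball x ε)
    (fun x _ => ball_mem_nhds x hε)
  obtain ⟨L, hL⟩ : ∃ L : ℕ, 2 * (Q.card : ℝ) ≤ (2 : ℝ) ^ (L : ℝ) := by
    obtain ⟨L, hL⟩ := pow_unbounded_of_one_lt (2 * (Q.card : ℝ)) (by norm_num : (1 : ℝ) < 2)
    exact ⟨L, by rw [Real.rpow_natCast]; exact hL.le⟩
  obtain ⟨V, hVopen, hKV, N, hN⟩ := exists_rarely_visited_nhds T hT Uᶜ hUopen.isClosed_compl hK0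
    ((η : ℝ) / (L + 1)) (by positivity)
  -- finite subcover of the complement of `V`
  obtain ⟨P, hPS, hPcov⟩ := hVopen.isClosed_compl.isCompact.elim_finite_subcover_image
    (b := S) (c := G) (fun q _ => hGopen q) (by
      intro x hx
      by_contra h
      exact hx (hKV h))
  obtain ⟨hPfin, hPcov⟩ := hPcov
  let P' : Finset (X × ℕ) := hPfin.toFinset
  have hP'S : ∀ p ∈ P', p ∈ S := fun p hp => hPS (hPfin.mem_toFinset.1 hp)
  have hsum : ∑ p ∈ P', (2 : ℝ) ^ (-(s * (p.2 : ℝ))) ≤ 1 / 2 := by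
    have h1 : ∑ p ∈ P', (2 : ℝ≥0∞) ^ (-(s * (p.2 : ℝ))) ≤ ENNReal.ofReal (1 / 2) := by
      refine le_trans ?_ hS3
      rw [← Finset.tsum_subtype' P' (fun p : X × ℕ => (2 : ℝ≥0∞) ^ (-(s * (p.2 : ℝ))))]
      exact ENNReal.tsum_mono_subtype (fun p : X × ℕ => (2 : ℝ≥0∞) ^ (-(s * (p.2 : ℝ))))
        (fun p hp => hP'S p hp)
    have h2 : ∑ p ∈ P', (2 : ℝ≥0∞) ^ (-(s * (p.2 : ℝ)))
        = ENNReal.ofReal (∑ p ∈ P', (2 : ℝ) ^ (-(s * (p.2 : ℝ)))) := by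
      rw [ENNReal.ofReal_sum_of_nonneg (fun p _ => by positivity)]
      refine Finset.sum_congr rfl fun p _ => ?_
      rw [← ENNReal.ofReal_rpow_of_pos (by norm_num)]
      norm_num
    rw [h2] at h1
    exact (ENNReal.ofReal_le_ofReal_iff (by norm_num)).1 h1
  let M : ℕ := P'.sup Prod.snd
  have hcard := sep_card_le T V (4 * ε) P' G M L Q (fun x => ball x ε) s hs.le
    (by
      intro p _ x hx y hy j hj
      have h1 := hx j hj
      have h2 := hy j hj
      have h3 := dist_triangle_left (T^[j] x) (T^[j] y) (T^[j] p.1)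
      linarith)
    (fun p hp => hS1 p (hP'S p hp))
    (fun p hp => Finset.le_sup (f := Prod.snd) hp)
    (by
      intro x hx
      obtain ⟨p, hp, hxp⟩ := mem_iUnion₂.1 (hPcov hx)
      exact ⟨p, hPfin.mem_toFinset.2 hp, hxp⟩)
    (by
      intro q _ x hx y hy
      have h3 := dist_triangle_right x y q
      have h1 : dist x q < ε := hx
      have h2 : dist y q < ε := hy
      linarith)
    (by
      intro x
      obtain ⟨q, hq, hxq⟩ := mem_iUnion₂.1 (hQ (mem_univ x))
      exact ⟨q, hq, hxq⟩)
    hsum hL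
  -- the resulting bound
  have hbound : ∀ n ≥ N, bowenC T univ (t + 3 * η) n (4 * ε) ≤
      (2 : ℝ≥0∞) ^ (s * M) * (2 : ℝ≥0∞) ^ (-((η : ℝ) * (n : ℝ))) := by
    intro n hn
    have hB : ∀ S : Finset X, DynSep T n (4 * ε) S →
        (S.card : ℝ) ≤ (2 : ℝ) ^ (s * ((n : ℝ) + M) + η * n) := by
      intro S hS
      have hδ0 : (0 : ℝ) ≤ (η : ℝ) / (L + 1) * n := by positivity
      refine (hcard n ⌊(η : ℝ) / (L + 1) * n⌋₊ S hS
        (fun x _ => Nat.le_floor (hN n hn x))).trans ?_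
      refine Real.rpow_le_rpow_of_exponent_le (by norm_num) ?_
      have h1 := Nat.floor_le hδ0
      have h2 : (L : ℝ) * (⌊(η : ℝ) / (L + 1) * n⌋₊ : ℝ) ≤ η * n := by
        calc _ ≤ ((L : ℝ) + 1) * ((η : ℝ) / (L + 1) * n) := by
              refine mul_le_mul (by linarith) h1 (by positivity) (by positivity)
          _ = η * n := by field_simp
      linarith
    refine (bowenC_univ_le T n (4 * ε) (by linarith) (t + 3 * η) _ hB).trans (le_of_eq ?_)
    rw [← ENNReal.ofReal_rpow_of_pos (by norm_num), ENNReal.ofReal_ofNat,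
      ← ENNReal.rpow_add _ _ (by norm_num) (by norm_num),
      ← ENNReal.rpow_add _ _ (by norm_num) (by norm_num)]
    congr 1
    push_cast
    rw [hs_def]
    ring
  have hlim : Tendsto (fun n : ℕ => (2 : ℝ≥0∞) ^ (s * M) * (2 : ℝ≥0∞) ^ (-((η : ℝ) * (n : ℝ))))
      atTop (𝓝 0) := by
    have hne : (2 : ℝ≥0∞) ^ (s * M) ≠ ∞ :=
      ENNReal.rpow_ne_top_of_nonneg (by positivity) (by norm_num)
    simpa using ENNReal.Tendsto.const_mul (tendsto_two_rpow η hη') (Or.inr hne)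
  refine le_antisymm (iSup_le fun n => ?_) zero_le
  refine ge_of_tendsto hlim ?_
  filter_upwards [eventually_ge_atTop n, eventually_ge_atTop N] with m hm hmN
  exact (bowenC_mono_order T univ _ _ hm).trans (hbound m hmN)

/-- for a set `Y` of totally full measure, `Y \ Per(T)` is either empty
or has full Bowen topological entropy. -/
theorem diff_periodic_empty_or_full_entropy (T : X → X) (hT : Continuous T)
    (Y : Set X)
    (hY : ∀ μ : Measure X, IsProbabilityMeasure μ → μ.map T = μ → μ Y = 1) :
    Y \ Function.periodicPts T = ∅ ∨
      bowenEntropy T (Y \ Function.periodicPts T) = bowenEntropy T Set.univ := by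
  right
  refine le_antisymm ?_ ?_
  · refine iSup₂_mono fun ε _ => ?_
    refine le_iInf fun t => ?_
    refine iInf_le_of_le ⟨t.1, ?_⟩ le_rfl
    refine le_antisymm ?_ zero_le
    exact (iSup_mono fun n => bowenC_mono_set T _ _ _ (subset_univ _)).trans t.2.le
  · refine iSup₂_le fun ε hε => ?_
    refine le_trans ?_ (le_iSup₂_of_le (ε / 4) (by positivity) le_rfl)
    refine le_iInf fun t => ?_
    refine ENNReal.le_of_forall_pos_le_add fun η hη _ => ?_
    have h0 : bowenC T (Y \ Function.periodicPts T) t.1 1 (ε / 4) = 0 :=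
      le_antisymm ((le_iSup (fun n => bowenC T (Y \ Function.periodicPts T) t.1 n (ε / 4)) 1).trans
        t.2.le)
        zero_le
    have h := main_estimate T hT Y hY (ε / 4) (by positivity) t.1 (η / 3) (by positivity) h0
    rw [mul_div_cancel₀ ε (by norm_num : (4 : ℝ) ≠ 0),
      mul_div_cancel₀ η (by norm_num : (3 : ℝ≥0) ≠ 0)] at h
    refine iInf_le_of_le ⟨t.1 + η, h⟩ ?_
    simp
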